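/- Let R and S be rings and let F : Mod R → Mod S be an additive functor. If F is right exact (preserves cokernels) and preserves arbitrary direct sums, then F preserves all small colimits and is a left adjoint. Consequently, an additive functor F : Mod R → Mod S is a left adjoint if and only if it is right exact and preserves arbitrary direct sums. -/

import Mathlib

open CategoryTheory CategoryTheory.Limits

universe u

/-- **Left adjoints between module categories.**
Let `R` and `S` be rings (right modules are modules over the opposite ring) and let
`F : Mod R ⥤ Mod S` be an additive functor.  If `F` is right exact (preserves cokernels)
and preserves arbitrary direct sums, then `F` preserves all small colimits and is a left
adjoint.  Consequently, an additive functor `F : Mod R ⥤ Mod S` is a left adjoint if and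
only if it is right exact and preserves arbitrary direct sums. -/
theorem additive_functor_leftAdjoint_iff_rightExact_and_preserves_directSums
    (R S : Type u) [Ring R] [Ring S]
    (F : ModuleCat.{u} Rᵐᵒᵖ ⥤ ModuleCat.{u} Sᵐᵒᵖ) [F.Additive] :
    (((∀ ⦃X Y : ModuleCat.{u} Rᵐᵒᵖ⦄ (f : X ⟶ Y),
          Nonempty (PreservesColimit (parallelPair f 0) F)) ∧
        (∀ (ι : Type u), Nonempty (PreservesColimitsOfShape (Discrete ι) F))) →
      (Nonempty (PreservesColimitsOfSize.{u, u} F) ∧ F.IsLeftAdjoint)) ∧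
    (F.IsLeftAdjoint ↔
      ((∀ ⦃X Y : ModuleCat.{u} Rᵐᵒᵖ⦄ (f : X ⟶ Y),
          Nonempty (PreservesColimit (parallelPair f 0) F)) ∧
        (∀ (ι : Type u), Nonempty (PreservesColimitsOfShape (Discrete ι) F)))) := by
  have key : ((∀ ⦃X Y : ModuleCat.{u} Rᵐᵒᵖ⦄ (f : X ⟶ Y),
          Nonempty (PreservesColimit (parallelPair f 0) F)) ∧
        (∀ (ι : Type u), Nonempty (PreservesColimitsOfShape (Discrete ι) F))) →
      (Nonempty (PreservesColimitsOfSize.{u, u} F) ∧ F.IsLeftAdjoint) := by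
    rintro ⟨hcok, hsum⟩
    have (X Y : ModuleCat.{u} Rᵐᵒᵖ) (f : X ⟶ Y) : PreservesColimit (parallelPair f 0) F :=
      (hcok f).some
    have (ι : Type u) : PreservesColimitsOfShape (Discrete ι) F := (hsum ι).some
    have : PreservesColimitsOfShape WalkingParallelPair F :=
      F.preservesCoequalizers_of_preservesCokernels
    have hF : PreservesColimitsOfSize.{u, u} F :=
      preservesColimits_of_preservesCoequalizers_and_coproducts F
    exact ⟨⟨hF⟩, isLeftAdjoint_of_preservesColimits_of_isSeparating
      (isSeparator_separator (ModuleCat.{u} Rᵐᵒᵖ)) F⟩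
  refine ⟨key, fun h ↦ ?_, fun h ↦ (key h).2⟩
  have adj := Adjunction.ofIsLeftAdjoint F
  have : PreservesColimitsOfSize.{0, 0} F := adj.leftAdjoint_preservesColimits
  have (ι : Type u) : PreservesColimitsOfShape (Discrete ι) F :=
    adj.leftAdjoint_preservesColimits.preservesColimitsOfShape
  exact ⟨fun _ _ _ ↦ ⟨inferInstance⟩, fun _ ↦ ⟨inferInstance⟩⟩
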